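/- Let r, i, j, k ≥ 0 be integers with k ≤ r, set m := r + i + j − 2k, assume m ≥ 0, and let z, u ∈ ℂ. Then ⟨ ∂^k( (X₁ − zY₁)^r · (X₂ − zY₂)^i · (X₂ − uY₂)^j ), (X − uY)^m ⟩ equals 0 if j ≠ k, and equals (−1)^m · (r!·k!/(r−k)!) · (z−u)^{m+k} if j = k. -/

import Mathlib

open MvPolynomial

/-- The operator `∂_{X₁}∂_{Y₂} − ∂_{Y₁}∂_{X₂}` on polynomials in `X₁,Y₁,X₂,Y₂`
(variables `0,1,2,3`), over `ℂ`. -/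
noncomputable def Dop (P : MvPolynomial (Fin 4) ℂ) : MvPolynomial (Fin 4) ℂ :=
  pderiv 0 (pderiv 3 P) - pderiv 1 (pderiv 2 P)

/-- The map `∂^k`: apply `∂_{X₁}∂_{Y₂} − ∂_{Y₁}∂_{X₂}` `k` times, then substitute
`X₁ = X₂ = X`, `Y₁ = Y₂ = Y`. -/
noncomputable def delk (k : ℕ) (P : MvPolynomial (Fin 4) ℂ) : MvPolynomial (Fin 2) ℂ :=
  aeval (![X 0, X 1, X 0, X 1] : Fin 4 → MvPolynomial (Fin 2) ℂ) (Dop^[k] P)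

/-- The `SL₂`-invariant pairing on `V_m ⊗ ℂ`, given on monomials by
`⟨X^a Y^{m−a}, X^b Y^{m−b}⟩ = (−1)^a (choose m a)⁻¹` if `a + b = m` and `0` otherwise. -/
noncomputable def pairC (m : ℕ) (P Q : MvPolynomial (Fin 2) ℂ) : ℂ :=
  ∑ a ∈ Finset.range (m + 1),
    (-1 : ℂ) ^ a * ((m.choose a : ℂ))⁻¹ *
      coeff (Finsupp.single 0 a + Finsupp.single 1 (m - a)) P *
      coeff (Finsupp.single 0 (m - a) + Finsupp.single 1 a) Q

lemma Dop_C_mul_pow_mul_pow_mul_pow (c z u : ℂ) (r i j : ℕ) :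
    Dop (C c * ((X 0 - C z * X 1) ^ r * (X 2 - C z * X 3) ^ i * (X 2 - C u * X 3) ^ j)) =
      C (c * (r * j * (z - u))) *
        ((X 0 - C z * X 1) ^ (r - 1) * (X 2 - C z * X 3) ^ i * (X 2 - C u * X 3) ^ (j - 1)) := by
  have h (a b : Fin 4) (hab : a ≠ b) : pderiv a (X b : MvPolynomial (Fin 4) ℂ) = 0 :=
    pderiv_X_of_ne hab.symm
  simp only [Dop, Derivation.leibniz, Derivation.leibniz_pow, map_sub, map_add, map_neg, map_mul,
    smul_eq_mul, pderiv_C, pderiv_X_self, h _ _ (show (0 : Fin 4) ≠ 1 by decide),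
    h _ _ (show (0 : Fin 4) ≠ 2 by decide), h _ _ (show (0 : Fin 4) ≠ 3 by decide),
    h _ _ (show (1 : Fin 4) ≠ 0 by decide), h _ _ (show (1 : Fin 4) ≠ 2 by decide),
    h _ _ (show (1 : Fin 4) ≠ 3 by decide), h _ _ (show (2 : Fin 4) ≠ 0 by decide),
    h _ _ (show (2 : Fin 4) ≠ 1 by decide), h _ _ (show (2 : Fin 4) ≠ 3 by decide),
    h _ _ (show (3 : Fin 4) ≠ 0 by decide), h _ _ (show (3 : Fin 4) ≠ 1 by decide),
    h _ _ (show (3 : Fin 4) ≠ 2 by decide), nsmul_eq_mul, Derivation.map_natCast, map_natCast,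
    mul_zero, add_zero, zero_add, sub_zero, zero_sub, smul_zero, mul_one]
  ring

lemma Dop_iterate_pow_mul_pow_mul_pow (z u : ℂ) (r i j k : ℕ) :
    Dop^[k] ((X 0 - C z * X 1) ^ r * (X 2 - C z * X 3) ^ i * (X 2 - C u * X 3) ^ j) =
      C (r.descFactorial k * j.descFactorial k * (z - u) ^ k) *
        ((X 0 - C z * X 1) ^ (r - k) * (X 2 - C z * X 3) ^ i * (X 2 - C u * X 3) ^ (j - k)) := by
  induction k with
  | zero => simp
  | succ k ih =>
    rw [Function.iterate_succ_apply', ih, Dop_C_mul_pow_mul_pow_mul_pow, Nat.sub_sub, Nat.sub_sub,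
      Nat.descFactorial_succ, Nat.descFactorial_succ]
    congr 2
    push_cast
    ring

lemma coeff_X_sub_C_mul_X_pow (u : ℂ) (a b : ℕ) :
    coeff (Finsupp.single 0 b + Finsupp.single 1 a)
        ((X 0 - C u * X 1 : MvPolynomial (Fin 2) ℂ) ^ (a + b)) =
      ((a + b).choose a : ℂ) * (-u) ^ a := by
  have hterm (n : ℕ) : (X 0 : MvPolynomial (Fin 2) ℂ) ^ n * (C (-u) * X 1) ^ (a + b - n) *
      ((a + b).choose n : MvPolynomial (Fin 2) ℂ) =
      monomial (Finsupp.single 0 n + Finsupp.single 1 (a + b - n))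
        ((-u) ^ (a + b - n) * ((a + b).choose n : ℂ)) := by
    rw [mul_pow, ← C_pow, X_pow_eq_monomial, X_pow_eq_monomial, ← map_natCast C,
      C_mul_monomial, monomial_mul, mul_comm, C_mul_monomial]
    congr 1
    ring
  rw [sub_eq_add_neg, ← neg_mul, ← C_neg, add_pow, coeff_sum]
  simp only [hterm, coeff_monomial]
  rw [Finset.sum_eq_single b]
  · rw [if_pos (by simp), Nat.add_sub_cancel, Nat.choose_symm_add, mul_comm]
  · intro n _ hn
    refine if_neg fun h => hn ?_
    simpa using DFunLike.congr_fun h 0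
  · intro hb
    exact absurd (Finset.mem_range.2 (by omega)) hb

lemma pairC_X_sub_C_mul_X_pow {m : ℕ} {P : MvPolynomial (Fin 2) ℂ} (hP : P.IsHomogeneous m)
    (u : ℂ) : pairC m P ((X 0 - C u * X 1) ^ m) = eval ![u, 1] P := by
  let e (a : ℕ) : Fin 2 →₀ ℕ := Finsupp.single 0 a + Finsupp.single 1 (m - a)
  have he : Function.Injective e := fun a b h => by
    simpa [e] using DFunLike.congr_fun h 0
  have hsub : P.support ⊆ (Finset.range (m + 1)).image e := by
    intro d hd
    have hdeg : d 0 + d 1 = m := by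
      rw [← Fin.sum_univ_two (f := d), ← Finsupp.degree_eq_sum, Finsupp.degree_eq_weight_one]
      exact hP (mem_support_iff.1 hd)
    refine Finset.mem_image.2 ⟨d 0, Finset.mem_range.2 (by omega), ?_⟩
    ext t
    fin_cases t
    · simp [e]
    · simp [e]
      omega
  rw [eval_eq', Finset.sum_subset hsub fun d _ hd => by
    rw [notMem_support_iff.1 hd, zero_mul], Finset.sum_image he.injOn, pairC]
  refine Finset.sum_congr rfl fun a ha => ?_
  obtain ⟨b, rfl⟩ := Nat.exists_eq_add_of_le (Nat.lt_succ_iff.1 (Finset.mem_range.1 ha))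
  have hc : ((a + b).choose a : ℂ) ≠ 0 :=
    Nat.cast_ne_zero.2 (Nat.choose_pos (Nat.le_add_right a b)).ne'
  rw [Nat.add_sub_cancel_left, coeff_X_sub_C_mul_X_pow]
  simp only [e, Fin.prod_univ_two, Nat.add_sub_cancel_left]
  simp only [Finsupp.add_apply, Finsupp.single_apply, Matrix.cons_val_zero, Matrix.cons_val_one,
    one_pow, mul_one]
  rw [neg_pow u a]
  have h1 : (-1 : ℂ) ^ a * (-1) ^ a = 1 := by rw [← mul_pow]; simp
  simp
  field_simp
  linear_combination (coeff (Finsupp.single 0 a + Finsupp.single 1 b) P * u ^ a) * h1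

/-- For `r, i, j, k ≥ 0` with `k ≤ r` and `m := r + i + j − 2k ≥ 0`,
and `z, u ∈ ℂ`:
`⟨∂^k((X₁−zY₁)^r (X₂−zY₂)^i (X₂−uY₂)^j), (X−uY)^m⟩` equals `0` if `j ≠ k`, and
equals `(−1)^m (r!·k!/(r−k)!) (z−u)^{m+k}` if `j = k`. -/
theorem stmt_6 (r i j k m : ℕ) (hkr : k ≤ r) (hm : r + i + j = m + 2 * k) (z u : ℂ) :
    pairC m
        (delk k ((X 0 - C z * X 1) ^ r * (X 2 - C z * X 3) ^ i * (X 2 - C u * X 3) ^ j))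
        ((X 0 - C u * X 1) ^ m) =
      if j = k then
        (-1 : ℂ) ^ m * ((r.factorial : ℂ) * (k.factorial : ℂ) / ((r - k).factorial : ℂ)) *
          (z - u) ^ (m + k)
      else 0 := by
  rw [delk, Dop_iterate_pow_mul_pow_mul_pow]
  rcases lt_or_ge j k with hjk | hjk
  · rw [if_neg hjk.ne, Nat.descFactorial_of_lt hjk]
    simp [pairC]
  · have hL (w : ℂ) (n : ℕ) :
        ((X 0 - C w * X 1 : MvPolynomial (Fin 2) ℂ) ^ n).IsHomogeneous n := by
      simpa using ((isHomogeneous_X ℂ (0 : Fin 2)).sub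
        (isHomogeneous_C_mul_X w (1 : Fin 2))).pow n
    simp only [map_mul, map_sub, map_pow, aeval_X, algHom_C, algebraMap_eq]
    have hm' : m = 0 + (r - k + i + (j - k)) := by omega
    have hhom := (isHomogeneous_C (Fin 2) ((r.descFactorial k * j.descFactorial k : ℂ) *
      (z - u) ^ k)).mul (((hL z (r - k)).mul (hL z i)).mul (hL u (j - k)))
    rw [← hm'] at hhom
    simp only [Matrix.cons_val]
    rw [map_mul C, map_mul C, C_pow, C_sub] at hhom
    rw [pairC_X_sub_C_mul_X_pow hhom]
    simp only [map_mul, map_sub, map_pow, eval_C, eval_X, Matrix.cons_val_zero,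
      Matrix.cons_val_one, mul_one, sub_self]
    split_ifs with h
    · subst h
      have hr : ((r - j).factorial : ℂ) * r.descFactorial j = r.factorial := by
        exact_mod_cast Nat.factorial_mul_descFactorial hkr
      have hne : ((r - j).factorial : ℂ) ≠ 0 := Nat.cast_ne_zero.2 (Nat.factorial_ne_zero _)
      rw [Nat.descFactorial_self, ← hr, mul_assoc ((r - j).factorial : ℂ),
        mul_div_cancel_left₀ _ hne, ← pow_add, show r - j + i = m by omega, Nat.sub_self, pow_zero, ← neg_sub z u, neg_pow (z - u) m]
      ring
    · rw [zero_pow (by omega), mul_zero, mul_zero]
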